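/- Let n be a natural number, S a subset of the index set Fin n, and let U : ℝⁿ → ℝ be twice continuously differentiable such that (∂²U/∂xᵢ∂xⱼ)(x) = 0 for all x ∈ ℝⁿ whenever i ∈ S and j ∉ S. Then U splits additively along S: for every x ∈ ℝⁿ, U(x) = U(Pₛ x) + U(P_{Sᶜ} x) − U(0), where Pₛ x is the vector whose i-th coordinate equals xᵢ if i ∈ S and 0 otherwise, and P_{Sᶜ} x is the vector whose i-th coordinate equals xᵢ if i ∉ S and 0 otherwise. -/

import Mathlib

/-- Partial derivative of `f` at `x` in the direction of the `i`-th
standard basis vector. -/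
noncomputable def pd {n : ℕ} (f : EuclideanSpace ℝ (Fin n) → ℝ) (i : Fin n)
    (x : EuclideanSpace ℝ (Fin n)) : ℝ :=
  fderiv ℝ f x (EuclideanSpace.single i 1)

open Classical in
/-- Coordinate projection of `x` onto the coordinates indexed by `S`
(the other coordinates are set to zero). -/
noncomputable def projS {n : ℕ} (S : Set (Fin n)) (x : EuclideanSpace ℝ (Fin n)) :
    EuclideanSpace ℝ (Fin n) :=
  WithLp.toLp 2 (fun i => if i ∈ S then x i else 0)

theorem fderiv_apply_eq_sum_pd {n : ℕ} (f : EuclideanSpace ℝ (Fin n) → ℝ)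
    (x v : EuclideanSpace ℝ (Fin n)) : fderiv ℝ f x v = ∑ i, v i * pd f i x := by
  have hv : v = ∑ i, v i • EuclideanSpace.single i (1 : ℝ) := by
    ext j
    simp [Finset.sum_apply, Pi.single_apply]
  conv_lhs => rw [hv]
  simp [map_sum, pd]

theorem add_eq_of_fderiv_apply_eq_zero {E : Type*} [NormedAddCommGroup E] [NormedSpace ℝ E]
    {f : E → ℝ} (hf : Differentiable ℝ f) {v : E} (h : ∀ x, fderiv ℝ f x v = 0) (y : E) :
    f (y + v) = f y := by
  have hline (t : ℝ) : HasDerivAt (fun t : ℝ => f (y + t • v)) 0 t := by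
    have hγ : HasDerivAt (fun t : ℝ => y + t • v) v t := by
      simpa using ((hasDerivAt_id t).smul_const v).const_add y
    have hcomp := (hf (y + t • v)).hasFDerivAt.comp_hasDerivAt t hγ
    rwa [h] at hcomp
  simpa using is_const_of_deriv_eq_zero (fun t => (hline t).differentiableAt)
    (fun t => (hline t).deriv) 1 0

theorem projS_add_projS_compl {n : ℕ} (S : Set (Fin n)) (x : EuclideanSpace ℝ (Fin n)) :
    projS S x + projS Sᶜ x = x := by
  ext i
  by_cases hi : i ∈ S <;> simp [projS, hi]

theorem stmt_9 (n : ℕ) (S : Set (Fin n))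
    (U : EuclideanSpace ℝ (Fin n) → ℝ) (hU : ContDiff ℝ 2 U)
    (hmix : ∀ (x : EuclideanSpace ℝ (Fin n)) (i j : Fin n),
      i ∈ S → j ∉ S → pd (pd U j) i x = 0) :
    ∀ x : EuclideanSpace ℝ (Fin n),
      U x = U (projS S x) + U (projS Sᶜ x) - U 0 := by
  intro x
  have hUd : Differentiable ℝ U := hU.differentiable (by norm_num)
  have hpd (j : Fin n) : Differentiable ℝ (pd U j) :=
    ((hU.fderiv_right (m := 1) (by norm_num)).differentiable (by norm_num)).clm_apply
      (differentiable_const _)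
  have hshift (j : Fin n) (hj : j ∉ S) (y : EuclideanSpace ℝ (Fin n)) :
      pd U j (y + projS S x) = pd U j y := by
    refine add_eq_of_fderiv_apply_eq_zero (hpd j) (fun z => ?_) y
    rw [fderiv_apply_eq_sum_pd]
    refine Finset.sum_eq_zero fun i _ => ?_
    by_cases hi : i ∈ S
    · simp [hmix z i j hi hj]
    · simp [projS, hi]
  have hUs : Differentiable ℝ (fun y => U (y + projS S x)) :=
    hUd.comp (differentiable_id.add_const _)
  have key := add_eq_of_fderiv_apply_eq_zero (hUs.sub hUd) (v := projS Sᶜ x) (fun z => by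
    rw [fderiv_sub (hUs z) (hUd z), fderiv_comp_add_right, sub_apply,
      fderiv_apply_eq_sum_pd, fderiv_apply_eq_sum_pd, ← Finset.sum_sub_distrib]
    refine Finset.sum_eq_zero fun j _ => ?_
    by_cases hj : j ∈ S
    · simp [projS, hj]
    · simp [hshift j hj z]) 0
  simp only [Pi.sub_apply, zero_add, add_comm (projS Sᶜ x), projS_add_projS_compl] at key
  linarith
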